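/- Let A be a finite alphabet and x : ℕ → A an infinite word. Let u, v be nonempty words over A forming a minimal pair, i.e., there do not exist words a, b with |a|+|b| < |u|+|v| and u, v ∈ {a,b}^*. Suppose there are positive integers p and κ such that: (i) neither u^p nor v^p is a factor of x; (ii) every factor of x of length L occurs in the prefix of x of length κ·L. Let D ≥ 10p²κ + p + 1. If x has a prefix that is a concatenation of D blocks, each block equal to u or to v, then x ∈ {u,v}^ω. -/

import Mathlib

/-- The factor of the infinite word `x` of length `n` starting at position `i`. -/
def factorAt {A : Type*} (x : ℕ → A) (i n : ℕ) : List A :=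
  (List.range n).map fun j => x (i + j)

/-- `w` is a factor of the infinite word `x`. -/
def IsFactor {A : Type*} (x : ℕ → A) (w : List A) : Prop :=
  ∃ i : ℕ, w = factorAt x i w.length

/-- The `n`-th power of the finite word `w`. -/
def wpow {A : Type*} (w : List A) (n : ℕ) : List A :=
  (List.replicate n w).flatten

/-- A nonempty finite word is primitive if it is not a proper power. -/
def Primitive {A : Type*} (w : List A) : Prop :=
  w ≠ [] ∧ ∀ (t : List A) (e : ℕ), 2 ≤ e → w ≠ wpow t e

/-- `w` occurs with unbounded exponent in the infinite word `x`. -/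
def UnboundedExponent {A : Type*} (x : ℕ → A) (w : List A) : Prop :=
  ∀ n : ℕ, 1 ≤ n → IsFactor x (wpow w n)

/-- `w` belongs to `{a,b}^*`, the submonoid generated by `a` and `b`. -/
def InStarPair {A : Type*} (a b w : List A) : Prop :=
  ∃ l : List (List A), (∀ t ∈ l, t = a ∨ t = b) ∧ w = l.flatten

/-- `(u, v)` is a minimal pair: there is no pair `(a, b)` of smaller total length
with `u, v ∈ {a,b}^*`. -/
def MinimalPair {A : Type*} (u v : List A) : Prop :=
  ¬ ∃ a b : List A, a.length + b.length < u.length + v.length ∧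
      InStarPair a b u ∧ InStarPair a b v

/-- The finite word `w` is a prefix of the infinite word `x`. -/
def WordPrefix {A : Type*} (x : ℕ → A) (w : List A) : Prop :=
  w = factorAt x 0 w.length

/-- The infinite word `x` belongs to `{u,v}^ω`, i.e. `x` is an infinite
concatenation of blocks, each equal to `u` or to `v`. -/
def InOmegaPair {A : Type*} (x : ℕ → A) (u v : List A) : Prop :=
  ∃ f : ℕ → List A, (∀ n, f n = u ∨ f n = v) ∧
    ∀ n : ℕ, WordPrefix x (((List.range n).map f).flatten)

/-- The morphism `{x,y}^* → Σ^*` sending `x` (encoded `false`) to `u` and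
`y` (encoded `true`) to `v`. -/
def sigmaMap {A : Type*} (u v : List A) (w : List Bool) : List A :=
  (w.map fun c => if c then v else u).flatten

/-- The number of occurrences of the factor `xy` (encoded `[false, true]`) in `w`. -/
def countXY (w : List Bool) : ℕ :=
  ((List.range w.length).filter fun i => decide ([false, true] <+: w.drop i)).length

section Factors

variable {A : Type*}

@[simp] theorem length_factorAt (x : ℕ → A) (i n : ℕ) : (factorAt x i n).length = n := by
  simp [factorAt]

theorem factorAt_add (x : ℕ → A) (i m n : ℕ) :
    factorAt x i (m + n) = factorAt x i m ++ factorAt x (i + m) n := by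
  simp [factorAt, List.range_add, Function.comp_def, Nat.add_assoc]

/-- Splitting an occurrence of a concatenation. -/
theorem eq_factorAt_append_iff (x : ℕ → A) (i : ℕ) (w z : List A) :
    w ++ z = factorAt x i (w ++ z).length ↔
      w = factorAt x i w.length ∧ z = factorAt x (i + w.length) z.length := by
  rw [List.length_append, factorAt_add]
  constructor
  · intro h
    exact List.append_inj h (by simp)
  · rintro ⟨h₁, h₂⟩
    rw [← h₁, ← h₂]

theorem IsFactor.left {x : ℕ → A} {w z : List A} (h : IsFactor x (w ++ z)) : IsFactor x w :=
  h.imp fun i hi => ((eq_factorAt_append_iff x i w z).1 hi).1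

theorem IsFactor.right {x : ℕ → A} {w z : List A} (h : IsFactor x (w ++ z)) : IsFactor x z := by
  obtain ⟨i, hi⟩ := h
  exact ⟨_, ((eq_factorAt_append_iff x i w z).1 hi).2⟩

theorem WordPrefix.anti {x : ℕ → A} {w z : List A} (h : WordPrefix x z) (hw : w <+: z) :
    WordPrefix x w := by
  obtain ⟨t, rfl⟩ := hw
  exact ((eq_factorAt_append_iff x 0 w t).1 h).1

/-- A factor occurring inside a prefix of `x` is a prefix of the corresponding suffix. -/
theorem WordPrefix.factorAt_prefix_drop {x : ℕ → A} {w : List A} (h : WordPrefix x w) {i n : ℕ}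
    (hin : i + n ≤ w.length) : factorAt x i n <+: w.drop i := by
  have hw : w = factorAt x 0 i ++ (factorAt x i n ++ factorAt x (i + n) (w.length - (i + n))) := by
    conv_lhs => rw [h, show w.length = i + (n + (w.length - (i + n))) by omega]
    rw [factorAt_add, factorAt_add, Nat.zero_add]
  have hd : w.drop i = factorAt x i n ++ factorAt x (i + n) (w.length - (i + n)) := by
    conv_lhs => rw [hw]
    exact List.drop_left' (length_factorAt x 0 i)
  rw [hd]
  exact List.prefix_append _ _

end Factors

section StarPair

variable {A : Type*} {a b : List A}

theorem InStarPair.left : InStarPair a b a := ⟨[a], by simp, by simp⟩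

theorem InStarPair.right : InStarPair a b b := ⟨[b], by simp, by simp⟩

theorem InStarPair.append {w z : List A} (hw : InStarPair a b w) (hz : InStarPair a b z) :
    InStarPair a b (w ++ z) := by
  obtain ⟨l, hl, rfl⟩ := hw
  obtain ⟨m, hm, rfl⟩ := hz
  refine ⟨l ++ m, fun t ht => ?_, by simp⟩
  rcases List.mem_append.1 ht with h | h
  exacts [hl t h, hm t h]

end StarPair

section Defect

variable {A : Type*}

/-- Substituting `i j` for the letter `j` compensates for removing the prefix `g i` from `g j`. -/
theorem flatMap_update_of_eq_append {ι : Type*} [DecidableEq ι] (g : ι → List A) {i j : ι}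
    (hij : i ≠ j) {z : List A} (hz : g j = g i ++ z) (w : List ι) :
    (w.flatMap fun k => if k = j then [i, j] else [k]).flatMap (Function.update g j z) =
      w.flatMap g := by
  induction w with
  | nil => rfl
  | cons k w ih =>
    rw [List.flatMap_cons, List.flatMap_append, ih, List.flatMap_cons]
    by_cases hk : k = j
    · subst hk
      simp [Function.update_of_ne hij, hz]
    · simp [hk]

/-- A quantitative defect theorem for three words: if two concatenations starting with different
generators agree on a prefix as long as the total length of the generators, then the generators
are concatenations of two words of smaller total length. -/
theorem exists_inStarPair_of_prefix_agree (n : ℕ) : ∀ (g : Fin 3 → List A), (∀ k, g k ≠ []) →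
    ∑ k, (g k).length = n → ∀ (i j : Fin 3) (P Q : List (Fin 3)) (W : List A), i ≠ j →
    W <+: (i :: P).flatMap g → W <+: (j :: Q).flatMap g → n ≤ W.length →
    ∃ a b : List A, a.length + b.length < n ∧ ∀ k, InStarPair a b (g k) := by
  induction n using Nat.strong_induction_on with
  | _ n ih =>
  intro g hg hn i j P Q W hij hP hQ hW
  wlog hle : (g i).length ≤ (g j).length generalizing i j P Q
  · exact this j i Q P hij.symm hQ hP (by omega)
  have hlen : ∀ k, (g k).length ≤ n := fun k =>
    hn ▸ Finset.single_le_sum (f := fun k => (g k).length) (fun _ _ => Nat.zero_le _)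
      (Finset.mem_univ k)
  have hpre : ∀ (k : Fin 3) (R : List (Fin 3)), W <+: (k :: R).flatMap g → g k <+: W := by
    intro k R h
    rw [List.flatMap_cons] at h
    exact List.prefix_of_prefix_length_le (List.prefix_append _ _) h ((hlen k).trans hW)
  have hiW := hpre i P hP
  obtain ⟨z, hz⟩ := List.prefix_of_prefix_length_le hiW (hpre j Q hQ) hle
  have hpos : ∀ k, 0 < (g k).length := fun k => List.length_pos_iff.2 (hg k)
  by_cases hz0 : z = []
  · obtain ⟨k, hki, hkj, hall⟩ : ∃ k : Fin 3, k ≠ i ∧ k ≠ j ∧ ∀ m, m = i ∨ m = j ∨ m = k := by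
      clear * - hij
      revert i j
      decide
    refine ⟨g i, g k, ?_, fun m => ?_⟩
    · have hsub : ∑ m ∈ ({i, j, k} : Finset (Fin 3)), (g m).length ≤ n :=
        hn ▸ Finset.sum_le_sum_of_subset (Finset.subset_univ _)
      rw [Finset.sum_insert (by simp [hij, hki.symm]), Finset.sum_insert (by simp [hkj.symm]),
        Finset.sum_singleton] at hsub
      have := hpos j
      omega
    · rcases hall m with rfl | rfl | rfl
      · exact .left
      · rw [← hz, hz0, List.append_nil]
        exact .left
      · exact .right
  · obtain ⟨V, rfl⟩ := hiW
    set g' := Function.update g j z with hg'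
    set σ : List (Fin 3) → List (Fin 3) :=
      fun w => w.flatMap fun k => if k = j then [i, j] else [k] with hσ
    have hσg : ∀ w, (σ w).flatMap g' = w.flatMap g :=
      flatMap_update_of_eq_append g hij hz.symm
    have hlj : (g j).length = (g i).length + z.length := by rw [← hz, List.length_append]
    have hsum : ∑ k, (g' k).length + (g i).length = n := by
      rw [← hn, ← Finset.add_sum_erase _ _ (Finset.mem_univ j),
        ← Finset.add_sum_erase (a := j) _ (fun k => (g k).length) (Finset.mem_univ j),
        Finset.sum_congr rfl (g := fun k => (g k).length) fun k hk => by
          rw [hg', Function.update_of_ne (Finset.ne_of_mem_erase hk)], hg', Function.update_self]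
      omega
    have hg'0 : ∀ k, g' k ≠ [] := by
      intro k
      by_cases hk : k = j
      · subst hk; simpa [hg'] using hz0
      · simpa [hg', hk] using hg k
    have hpi := hpos i
    have hVP : V <+: P.flatMap g := by
      simpa [List.flatMap_cons, List.prefix_append_right_inj] using hP
    have hVQ : V <+: (j :: σ Q).flatMap g' := by
      rw [List.flatMap_cons, ← hz, List.append_assoc, List.prefix_append_right_inj] at hQ
      rw [List.flatMap_cons, hσg, hg', Function.update_self]
      exact hQ
    have hVlen : ∑ k, (g' k).length ≤ V.length := by
      rw [List.length_append] at hW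
      omega
    have hVpos : 0 < V.length := by
      refine lt_of_lt_of_le (List.length_pos_iff.2 (hg'0 j)) (le_trans ?_ hVlen)
      exact Finset.single_le_sum (f := fun k => (g' k).length) (fun _ _ => Nat.zero_le _)
        (Finset.mem_univ j)
    obtain ⟨k, R, hkR, hkj⟩ : ∃ k R, σ P = k :: R ∧ k ≠ j := by
      cases P with
      | nil =>
        have := hVP.length_le
        simp at this
        simp [this] at hVpos
      | cons k P =>
        by_cases hk : k = j
        · exact ⟨i, j :: σ P, by simp [hσ, hk], hij⟩
        · exact ⟨k, σ P, by simp [hσ, hk], hk⟩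
    obtain ⟨a, b, hab, hmem⟩ := ih (∑ k, (g' k).length) (by omega) g' hg'0 rfl k j R (σ Q) V hkj
      (by rw [← hkR, hσg]; exact hVP) hVQ hVlen
    have hne : ∀ m, m ≠ j → InStarPair a b (g m) := fun m hm => by
      simpa [hg', Function.update_of_ne hm] using hmem m
    refine ⟨a, b, by omega, fun m => ?_⟩
    by_cases hm : m = j
    · subst hm
      rw [← hz]
      exact (hne i hij).append (by simpa [hg'] using hmem m)
    · exact hne m hm

end Defect

section Blocks

variable {A : Type*} {u v : List A}

@[simp] theorem sigmaMap_nil : sigmaMap u v [] = [] := rfl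

@[simp] theorem sigmaMap_cons (c : Bool) (l : List Bool) :
    sigmaMap u v (c :: l) = (if c then v else u) ++ sigmaMap u v l := rfl

@[simp] theorem sigmaMap_append (l m : List Bool) :
    sigmaMap u v (l ++ m) = sigmaMap u v l ++ sigmaMap u v m := by
  simp [sigmaMap]

theorem length_block_le (c : Bool) :
    (if c then v else u).length ≤ u.length + v.length := by
  cases c <;> simp

theorem MinimalPair.not_prefix_left (h : MinimalPair u v) (hu : u ≠ []) : ¬ u <+: v := by
  rintro ⟨z, rfl⟩
  have := List.length_pos_iff.2 hu
  refine h ⟨u, z, ?_, .left, .append .left .right⟩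
  simp only [List.length_append]
  omega

theorem MinimalPair.not_prefix_right (h : MinimalPair u v) (hv : v ≠ []) : ¬ v <+: u := by
  rintro ⟨z, rfl⟩
  have := List.length_pos_iff.2 hv
  refine h ⟨v, z, ?_, .append .left .right, .left⟩
  simp only [List.length_append]
  omega

theorem MinimalPair.not_prefix_block (h : MinimalPair u v) (hu : u ≠ []) (hv : v ≠ [])
    {c d : Bool} (hcd : c ≠ d) : ¬ (if c then v else u) <+: (if d then v else u) := by
  cases c <;> cases d <;> simp_all [h.not_prefix_left hu, h.not_prefix_right hv]

/-- A minimal pair is a prefix code. -/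
theorem MinimalPair.exists_append_of_sigmaMap_append (h : MinimalPair u v) (hu : u ≠ [])
    (hv : v ≠ [])
    {r : List A} : ∀ {b m : List Bool}, sigmaMap u v b ++ r <+: sigmaMap u v m →
      ∃ e, m = b ++ e ∧ r <+: sigmaMap u v e
  | [], m, hm => ⟨m, rfl, hm⟩
  | c :: b, [], hm => by
    have := hm.length_le
    have h1 := List.length_pos_iff.2 hu
    have h2 := List.length_pos_iff.2 hv
    cases c <;> simp at this <;> simp_all
  | c :: b, d :: m, hm => by
    simp only [sigmaMap_cons, List.append_assoc] at hm
    by_cases hcd : c = d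
    · subst hcd
      obtain ⟨e, rfl, he⟩ :=
        h.exists_append_of_sigmaMap_append hu hv ((List.prefix_append_right_inj _).1 hm)
      exact ⟨e, rfl, he⟩
    · exfalso
      rcases List.prefix_or_prefix_of_prefix ((List.prefix_append _ _).trans hm)
        (List.prefix_append _ _) with h' | h'
      · exact h.not_prefix_block hu hv hcd h'
      · exact h.not_prefix_block hu hv (Ne.symm hcd) h'

/-- Synchronization with a shift `s` that is a proper nonempty prefix of a block is impossible. -/
theorem MinimalPair.not_prefix_of_shift (h : MinimalPair u v) (hu : u ≠ []) (hv : v ≠ [])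
    {c : Bool} {l m : List Bool} {s t : List A} (hs : s ≠ []) (ht : t ≠ [])
    (hc : (if c then v else u) = s ++ t)
    (hpre : t ++ sigmaMap u v l <+: sigmaMap u v m)
    (hlen : u.length + v.length ≤ (t ++ sigmaMap u v l).length) : False := by
  set o : List A := if c then u else v with ho
  set g : Fin 3 → List A := ![s, t, o] with hg
  set τ : List Bool → List (Fin 3) := fun w => w.flatMap fun d => if d = c then [0, 1] else [2]
    with hτ
  have hτg : ∀ w, (τ w).flatMap g = sigmaMap u v w := by
    intro w
    induction w with
    | nil => rfl
    | cons d w ih =>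
      rw [sigmaMap_cons, ← ih]
      by_cases hd : d = c
      · subst hd; simp [hτ, hg, hc]
      · have : (if d then v else u) = o := by cases c <;> cases d <;> simp_all
        simp [hτ, hg, hd, this]
  have hst : s.length + t.length + o.length = u.length + v.length := by
    have := congrArg List.length hc
    rw [List.length_append] at this
    rw [← this]
    cases c <;> simp [ho, Nat.add_comm]
  have hsum : ∑ k, (g k).length = u.length + v.length := by
    rw [Fin.sum_univ_three, ← hst]; rfl
  have hg0 : ∀ k, g k ≠ [] := by
    intro k
    fin_cases k
    · exact hs
    · exact ht
    · change o ≠ []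
      cases c <;> simp_all
  obtain ⟨j, Q, hjQ, hj⟩ : ∃ j Q, τ m = j :: Q ∧ (1 : Fin 3) ≠ j := by
    cases m with
    | nil =>
      have h₁ := hpre.length_le
      have h₂ := List.length_pos_iff.2 hu
      rw [sigmaMap_nil, List.length_nil] at h₁
      omega
    | cons d m =>
      by_cases hd : d = c
      · exact ⟨0, 1 :: τ m, by simp [hτ, hd], by decide⟩
      · exact ⟨2, τ m, by simp [hτ, hd], by decide⟩
  obtain ⟨a, b, hab, hmem⟩ := exists_inStarPair_of_prefix_agree _ g hg0 hsum 1 j (τ l) Q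
    (t ++ sigmaMap u v l) hj (by rw [List.flatMap_cons, hτg]; exact List.prefix_rfl)
    (by rw [← hjQ, hτg]; exact hpre) hlen
  have hblock : InStarPair a b (if c then v else u) := hc ▸ (hmem 0).append (hmem 1)
  have hother : InStarPair a b o := hmem 2
  refine h ⟨a, b, hab, ?_⟩
  cases c
  · exact ⟨hblock, hother⟩
  · exact ⟨hother, hblock⟩

/-- Long concatenations of blocks of a minimal pair are synchronizing. -/
theorem MinimalPair.exists_sigmaMap_eq_shift (h : MinimalPair u v) (hu : u ≠ []) (hv : v ≠ [])
    {m : List Bool} : ∀ {l : List Bool} {s : List A},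
      sigmaMap u v l <+: s ++ sigmaMap u v m →
      s.length + (u.length + v.length) ≤ (sigmaMap u v l).length →
      ∃ a b, l = a ++ b ∧ sigmaMap u v a = s
  | [], s, _, hlen => by
    have := List.length_pos_iff.2 hu
    rw [sigmaMap_nil, List.length_nil] at hlen
    omega
  | c :: l, s, hpre, hlen => by
    by_cases hs : s = []
    · exact ⟨[], c :: l, rfl, hs.symm⟩
    rw [sigmaMap_cons] at hpre hlen
    rcases List.prefix_or_prefix_of_prefix ((List.prefix_append _ _).trans hpre)
      (List.prefix_append _ _) with ⟨s', rfl⟩ | ⟨t, ht⟩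
    · rw [List.append_assoc, List.prefix_append_right_inj] at hpre
      simp only [List.length_append] at hlen
      obtain ⟨a, b, rfl, ha⟩ := h.exists_sigmaMap_eq_shift hu hv hpre (by omega)
      exact ⟨c :: a, b, rfl, by rw [sigmaMap_cons, ha]⟩
    · by_cases ht0 : t = []
      · exact ⟨[c], l, rfl, by simp [← ht, ht0]⟩
      · rw [← ht, List.append_assoc] at hpre hlen
        rw [List.length_append, Nat.add_le_add_iff_left] at hlen
        exact (h.not_prefix_of_shift hu hv hs ht0 ht.symm
          ((List.prefix_append_right_inj _).1 hpre) hlen).elim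

/-- A suffix of whole blocks of prescribed length, up to the length of a block. -/
theorem exists_suffix_sigmaMap_length (K : ℕ) : ∀ l : List Bool, K ≤ (sigmaMap u v l).length →
    ∃ l₁ l₂, l = l₁ ++ l₂ ∧ K ≤ (sigmaMap u v l₂).length ∧
      (sigmaMap u v l₂).length ≤ K + (u.length + v.length)
  | [], h => ⟨[], [], rfl, h, by simp⟩
  | c :: l, h => by
    by_cases hK : K ≤ (sigmaMap u v l).length
    · obtain ⟨l₁, l₂, rfl, h₁, h₂⟩ := exists_suffix_sigmaMap_length K l hK
      exact ⟨c :: l₁, l₂, rfl, h₁, h₂⟩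
    · refine ⟨[], c :: l, rfl, h, ?_⟩
      have := length_block_le (u := u) (v := v) c
      rw [sigmaMap_cons, List.length_append]
      omega

theorem exists_drop_sigmaMap_eq : ∀ (l : List Bool) (i : ℕ),
    ∃ m s, (sigmaMap u v l).drop i = s ++ sigmaMap u v m ∧ s.length ≤ u.length + v.length
  | [], i => ⟨[], [], by simp, by simp⟩
  | c :: l, i => by
    by_cases hi : (if c then v else u).length ≤ i
    · obtain ⟨m, s, h, hs⟩ := exists_drop_sigmaMap_eq l (i - (if c then v else u).length)
      refine ⟨m, s, ?_, hs⟩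
      rw [sigmaMap_cons, List.drop_append, List.drop_eq_nil_of_le hi, List.nil_append, h]
    · refine ⟨l, (if c then v else u).drop i, ?_, ?_⟩
      · rw [sigmaMap_cons, List.drop_append_of_le_length (by omega)]
      · have := length_block_le (u := u) (v := v) c
        rw [List.length_drop]
        omega

theorem sigmaMap_replicate (n : ℕ) (c : Bool) :
    sigmaMap u v (List.replicate n c) = wpow (if c then v else u) n := by
  simp [sigmaMap, wpow]

theorem length_block_le_of_mem {c : Bool} {l : List Bool} (h : c ∈ l) :
    (if c then v else u).length ≤ (sigmaMap u v l).length := by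
  obtain ⟨s, t, rfl⟩ := List.append_of_mem h
  simp only [sigmaMap_append, sigmaMap_cons, List.length_append]
  omega

theorem add_length_le_of_mem : ∀ {l : List Bool}, false ∈ l → true ∈ l →
    u.length + v.length ≤ (sigmaMap u v l).length
  | false :: l, _, ht => by
    have := length_block_le_of_mem (u := u) (v := v) (c := true) (l := l) (by simpa using ht)
    simp at this ⊢
    omega
  | true :: l, hf, _ => by
    have := length_block_le_of_mem (u := u) (v := v) (c := false) (l := l) (by simpa using hf)
    simp at this ⊢
    omega

/-- In the absence of `p`-th powers of the blocks, any `p` consecutive blocks involve both. -/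
theorem add_length_le_of_isFactor {x : ℕ → A} {p : ℕ} (hup : ¬ IsFactor x (wpow u p))
    (hvp : ¬ IsFactor x (wpow v p)) {l : List Bool} (hl : l.length = p)
    (hx : IsFactor x (sigmaMap u v l)) :
    u.length + v.length ≤ (sigmaMap u v l).length := by
  have key : ∀ c : Bool, ¬ IsFactor x (wpow (if c then v else u) p) → (!c) ∈ l := by
    intro c hc
    by_contra hmem
    have : l = List.replicate p c := by
      refine List.eq_replicate_iff.2 ⟨hl, fun d hd => ?_⟩
      by_contra hdc
      exact hmem (by rwa [← Bool.eq_not_of_ne hdc])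
    rw [this, sigmaMap_replicate] at hx
    exact hc hx
  exact add_length_le_of_mem (key true (by simpa using hvp)) (key false (by simpa using hup))

theorem mul_add_length_le_of_isFactor {x : ℕ → A} {p : ℕ} (hup : ¬ IsFactor x (wpow u p))
    (hvp : ¬ IsFactor x (wpow v p)) (q : ℕ) : ∀ {l : List Bool}, q * p ≤ l.length →
      IsFactor x (sigmaMap u v l) → q * (u.length + v.length) ≤ (sigmaMap u v l).length := by
  induction q with
  | zero => simp
  | succ q ih =>
    intro l hl hx
    rw [Nat.succ_mul] at hl
    rw [← List.take_append_drop p l, sigmaMap_append] at hx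
    have h₁ := add_length_le_of_isFactor hup hvp (l := l.take p) (by simp; omega) hx.left
    have h₂ := ih (l := l.drop p) (by simp; omega) hx.right
    rw [← List.take_append_drop p l, sigmaMap_append, List.length_append, Nat.succ_mul]
    omega

theorem exists_sigmaMap_eq_flatten : ∀ {l : List (List A)}, (∀ t ∈ l, t = u ∨ t = v) →
    ∃ m : List Bool, m.length = l.length ∧ sigmaMap u v m = l.flatten
  | [], _ => ⟨[], rfl, rfl⟩
  | t :: l, h => by
    obtain ⟨m, hm, hl⟩ := exists_sigmaMap_eq_flatten fun s hs => h s (List.mem_cons_of_mem t hs)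
    rcases h t List.mem_cons_self with rfl | rfl
    · exact ⟨false :: m, by simp [hm], by simp [hl]⟩
    · exact ⟨true :: m, by simp [hm], by simp [hl]⟩

/-- If every sufficiently long factorization of a prefix can be prolonged, the whole infinite word
factors into blocks. -/
theorem inOmegaPair_of_extend {x : ℕ → A} {l : List Bool} (hl : WordPrefix x (sigmaMap u v l))
    (hl0 : l ≠ [])
    (hext : ∀ m : List Bool, l.length ≤ m.length → WordPrefix x (sigmaMap u v m) →
      ∃ c, WordPrefix x (sigmaMap u v (m ++ [c]))) :
    InOmegaPair x u v := by
  choose! next hnext using hext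
  let F : ℕ → List Bool := fun n => Nat.rec l (fun _ m => m ++ [next m]) n
  have hF : ∀ n, F (n + 1) = F n ++ [next (F n)] := fun _ => rfl
  have hlen : ∀ n, (F n).length = l.length + n := by
    intro n
    induction n with
    | zero => rfl
    | succ n ih => rw [hF, List.length_append, ih]; rfl
  have hpre : ∀ n, WordPrefix x (sigmaMap u v (F n)) := by
    intro n
    induction n with
    | zero => exact hl
    | succ n ih => exact hnext _ (by rw [hlen]; omega) ih
  have hmono : ∀ n m, n ≤ m → F n <+: F m := by
    intro n m hnm
    induction hnm with
    | refl => exact List.prefix_rfl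
    | step _ ih => exact ih.trans (by rw [Nat.succ_eq_add_one, hF]; exact List.prefix_append _ _)
  have hpos := List.length_pos_iff.2 hl0
  have hlt : ∀ n, n < (F n).length := fun n => by rw [hlen]; omega
  refine ⟨fun n => if (F n)[n]'(hlt n) then v else u, fun n => ?_, fun n => ?_⟩
  · by_cases h : (F n)[n]'(hlt n) = true <;> simp [h]
  · have htake : (List.range n).map (fun k => (F k)[k]'(hlt k)) = (F n).take n := by
      refine List.ext_getElem (by simp [hlen]) fun k h₁ h₂ => ?_
      simp only [List.getElem_map, List.getElem_range, List.getElem_take]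
      exact (hmono k n (by simp at h₁; omega)).getElem (hlt k)
    have hsig : ((List.range n).map fun k => if (F k)[k]'(hlt k) then v else u).flatten =
        sigmaMap u v ((F n).take n) := by
      rw [← htake, sigmaMap, List.map_map]
      rfl
    rw [hsig]
    refine (hpre n).anti ⟨sigmaMap u v ((F n).drop n), ?_⟩
    rw [← sigmaMap_append, List.take_append_drop]

end Blocks

/-- Let `u`, `v` be a minimal pair of nonempty words such that neither `u^p` nor `v^p` is
a factor of the infinite word `x`, and suppose every factor of `x` of length `L` occurs in
the prefix of `x` of length `κ·L`. If `D ≥ 10p²κ + p + 1` and `x` has a prefix that is a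
concatenation of `D` blocks, each equal to `u` or `v`, then `x ∈ {u,v}^ω`. -/
theorem prefix_D_blocks_implies_omega {A : Type*} [Fintype A] (x : ℕ → A)
    (u v : List A) (hu : u ≠ []) (hv : v ≠ []) (hmin : MinimalPair u v)
    (p κ : ℕ) (hp : 0 < p) (hκ : 0 < κ)
    (hup : ¬ IsFactor x (wpow u p)) (hvp : ¬ IsFactor x (wpow v p))
    (hocc : ∀ w : List A, IsFactor x w →
      ∃ i : ℕ, i + w.length ≤ κ * w.length ∧ w = factorAt x i w.length)
    (D : ℕ) (hD : 10 * p ^ 2 * κ + p + 1 ≤ D)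
    (hpre : ∃ l : List (List A), l.length = D ∧ (∀ t ∈ l, t = u ∨ t = v) ∧
      WordPrefix x l.flatten) :
    InOmegaPair x u v := by
  set N := u.length + v.length with hN
  have hNpos : 0 < N := by
    have := List.length_pos_iff.2 hu
    omega
  obtain ⟨l, hlD, hl, hlx⟩ := hpre
  obtain ⟨l', hl', hll'⟩ := exists_sigmaMap_eq_flatten hl
  rw [← hll'] at hlx
  rw [hlD] at hl'
  have hlong : ∀ m : List Bool, D ≤ m.length → WordPrefix x (sigmaMap u v m) →
      10 * κ * N ≤ (sigmaMap u v m).length := by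
    intro m hm hmx
    refine mul_add_length_le_of_isFactor hup hvp (10 * κ) ?_ ⟨0, hmx⟩
    nlinarith [Nat.mul_le_mul_left (10 * κ * p) hp]
  refine inOmegaPair_of_extend hlx (List.ne_nil_of_length_pos (by omega)) fun m hm hmx => ?_
  have hκN : N ≤ κ * N := Nat.le_mul_of_pos_left N hκ
  obtain ⟨m₁, m₂, rfl, hm₂, hm₂'⟩ := exists_suffix_sigmaMap_length (u := u) (v := v) (2 * N) m
    (by have := hlong m (by omega) hmx; rw [Nat.mul_assoc] at this; omega)
  rw [← hN] at hm₂'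
  set E := (sigmaMap u v m₁).length with hE
  set r := factorAt x (E + (sigmaMap u v m₂).length) N with hr
  have hmx₂ : sigmaMap u v m₂ = factorAt x E (sigmaMap u v m₂).length := by
    rw [sigmaMap_append] at hmx
    simpa [hE] using ((eq_factorAt_append_iff x 0 _ _).1 hmx).2
  obtain ⟨i, hi, hix⟩ := hocc (sigmaMap u v m₂ ++ r)
    ⟨E, (eq_factorAt_append_iff x E _ _).2 ⟨hmx₂, by simp [hr]⟩⟩
  have hrl : r.length = N := length_factorAt _ _ _
  have hwl : (sigmaMap u v m₂ ++ r).length ≤ 4 * N := by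
    rw [List.length_append, hrl]
    omega
  have hiL : i + (sigmaMap u v m₂ ++ r).length ≤ (sigmaMap u v l').length := by
    have h₁ := hlong l' hl'.ge hlx
    have h₂ := Nat.mul_le_mul_left κ hwl
    nlinarith
  have hdrop := hlx.factorAt_prefix_drop hiL
  rw [← hix] at hdrop
  obtain ⟨d, s, hds, hs⟩ := exists_drop_sigmaMap_eq (u := u) (v := v) l' i
  rw [hds] at hdrop
  obtain ⟨a, b, rfl, rfl⟩ := hmin.exists_sigmaMap_eq_shift hu hv
    ((List.prefix_append _ _).trans hdrop) (by omega)
  rw [sigmaMap_append, List.append_assoc, List.prefix_append_right_inj] at hdrop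
  obtain ⟨e, rfl, hre⟩ := hmin.exists_append_of_sigmaMap_append hu hv hdrop
  cases e with
  | nil =>
    have := hre.length_le
    rw [hrl, sigmaMap_nil, List.length_nil] at this
    omega
  | cons c e =>
    have hcr : (if c then v else u) <+: r :=
      List.prefix_of_prefix_length_le (List.prefix_append _ _) hre
        (hrl ▸ length_block_le (u := u) (v := v) c)
    refine ⟨c, WordPrefix.anti (z := sigmaMap u v (m₁ ++ (a ++ b)) ++ r) ?_ ?_⟩
    · refine (eq_factorAt_append_iff x 0 _ _).2 ⟨hmx, ?_⟩
      rw [hrl, hr, Nat.zero_add, sigmaMap_append m₁, List.length_append]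
    · rw [sigmaMap_append, List.prefix_append_right_inj]
      simpa using hcr
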